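/- For every integer ℓ ≥ 2, every 4-vertex-critical graph in 𝒢_ℓ has neither a K2-cut nor a P3-cut. -/

import Mathlib

open SimpleGraph

variable {V : Type*}

/-- The list of internal vertices of a walk (its support minus the two ends). -/
def interiorL {G : SimpleGraph V} {a b : V} (p : G.Walk a b) : List V :=
  p.support.tail.dropLast

/-- `p` is an induced path of `G`: a path such that the only edges of `G` between
vertices of `p` are the edges of `p`. -/
def IsInducedPath (G : SimpleGraph V) {a b : V} (p : G.Walk a b) : Prop :=
  p.IsPath ∧ ∀ x ∈ p.support, ∀ y ∈ p.support, G.Adj x y → s(x, y) ∈ p.edges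

/-- A hole of `G`: an induced (chordless) cycle of length at least 4. -/
def IsHole (G : SimpleGraph V) {v : V} (c : G.Walk v v) : Prop :=
  c.IsCycle ∧ 4 ≤ c.length ∧
    ∀ x ∈ c.support, ∀ y ∈ c.support, G.Adj x y → s(x, y) ∈ c.edges

/-- An odd hole of `G`: a hole of odd length. -/
def IsOddHole (G : SimpleGraph V) {v : V} (c : G.Walk v v) : Prop :=
  IsHole G c ∧ Odd c.length

/-- `G ∈ 𝒢ℓ`: `G` has girth `2ℓ+1` and every odd hole of `G` has length exactly `2ℓ+1`
(equivalently, no odd hole of length at least `2ℓ+3`). -/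
def InGFamily (ℓ : ℕ) (G : SimpleGraph V) : Prop :=
  G.egirth = (2 * ℓ + 1 : ℕ) ∧
    ∀ (v : V) (c : G.Walk v v), IsOddHole G c → c.length = 2 * ℓ + 1

/-- `G` is `k`-vertex-critical: `χ(G) = k` and `χ(G − v) < k` for every vertex `v`. -/
def VertexCritical (k : ℕ) (G : SimpleGraph V) : Prop :=
  G.chromaticNumber = (k : ℕ∞) ∧
    ∀ v : V, (G.induce ({v}ᶜ : Set V)).chromaticNumber < (k : ℕ∞)

/-- An odd `K₄`-subdivision in `G`: four distinct branch vertices `u1, u2, u3, u4`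
joined by six internally disjoint paths (the arrises), such that the four face cycles
are all odd holes of `G`. -/
structure OddK4 (G : SimpleGraph V) where
  u1 : V
  u2 : V
  u3 : V
  u4 : V
  /-- the arris joining `u1` and `u2` -/
  P1 : G.Walk u1 u2
  /-- the arris joining `u3` and `u4` -/
  P2 : G.Walk u3 u4
  /-- the arris joining `u2` and `u3` -/
  Q1 : G.Walk u2 u3
  /-- the arris joining `u1` and `u4` -/
  Q2 : G.Walk u1 u4
  /-- the arris joining `u1` and `u3` -/
  L1 : G.Walk u1 u3
  /-- the arris joining `u2` and `u4` -/
  L2 : G.Walk u2 u4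
  hP1 : P1.IsPath
  hP2 : P2.IsPath
  hQ1 : Q1.IsPath
  hQ2 : Q2.IsPath
  hL1 : L1.IsPath
  hL2 : L2.IsPath
  /-- the four branch vertices are pairwise distinct -/
  hnodup : List.Nodup [u1, u2, u3, u4]
  /-- the interiors of the six arrises are pairwise disjoint -/
  hdisj : List.Pairwise List.Disjoint
    [interiorL P1, interiorL P2, interiorL Q1, interiorL Q2, interiorL L1, interiorL L2]
  /-- no branch vertex lies in the interior of an arris -/
  hbranch : ∀ x ∈ interiorL P1 ++ interiorL P2 ++ interiorL Q1 ++ interiorL Q2 ++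
      interiorL L1 ++ interiorL L2, x ∉ [u1, u2, u3, u4]
  /-- the face `u1u2u3` is an odd hole of `G` -/
  face1 : IsOddHole G (P1.append (Q1.append L1.reverse))
  /-- the face `u1u2u4` is an odd hole of `G` -/
  face2 : IsOddHole G (P1.append (L2.append Q2.reverse))
  /-- the face `u1u3u4` is an odd hole of `G` -/
  face3 : IsOddHole G (L1.append (P2.append Q2.reverse))
  /-- the face `u2u3u4` is an odd hole of `G` -/
  face4 : IsOddHole G (Q1.append (P2.append L2.reverse))

/-- The subgraph of `G` formed by an odd `K₄`-subdivision. -/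
def OddK4.toSubgraph {G : SimpleGraph V} (K : OddK4 G) : G.Subgraph :=
  K.P1.toSubgraph ⊔ K.P2.toSubgraph ⊔ K.Q1.toSubgraph ⊔ K.Q2.toSubgraph ⊔
    K.L1.toSubgraph ⊔ K.L2.toSubgraph

/-- The vertex set of an odd `K₄`-subdivision. -/
def OddK4.verts {G : SimpleGraph V} (K : OddK4 G) : Set V :=
  K.toSubgraph.verts

/-- `X` is a vertex cut of `G`: deleting `X` leaves a disconnected graph. -/
def IsVertexCut (G : SimpleGraph V) (X : Set V) : Prop :=
  ¬ (G.induce (Xᶜ : Set V)).Preconnected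

/-- `v` is a cut-vertex (`K₁`-cut) of `G`: some two vertices are connected in `G`
but not in `G − v`. -/
def IsCutVertex (G : SimpleGraph V) (v : V) : Prop :=
  ∃ a b : V, ∃ (ha : a ∈ ({v}ᶜ : Set V)) (hb : b ∈ ({v}ᶜ : Set V)),
    G.Reachable a b ∧ ¬ (G.induce ({v}ᶜ : Set V)).Reachable ⟨a, ha⟩ ⟨b, hb⟩

/-- `G` has a `K₂`-cut: a pair of adjacent vertices whose deletion disconnects `G`. -/
def HasK2Cut (G : SimpleGraph V) : Prop :=
  ∃ u v : V, G.Adj u v ∧ ¬ (G.induce (({u, v} : Set V)ᶜ)).Preconnected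

/-- `G` has a `P₃`-cut: a path on three vertices whose deletion disconnects `G`. -/
def HasP3Cut (G : SimpleGraph V) : Prop :=
  ∃ u v w : V, G.Adj u v ∧ G.Adj v w ∧ u ≠ w ∧
    ¬ (G.induce (({u, v, w} : Set V)ᶜ)).Preconnected

/-- The closed neighbourhood `N[S]` of a set `S` of vertices. -/
def closedNbhd (G : SimpleGraph V) (S : Set V) : Set V :=
  S ∪ {v | ∃ u ∈ S, G.Adj u v}

/-- `S` is the vertex set of a (connected) component of `G − X`. -/
def IsComponentOf (G : SimpleGraph V) (X S : Set V) : Prop :=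
  S.Nonempty ∧ Disjoint S X ∧ (G.induce S).Connected ∧
    ∀ a ∈ S, ∀ b, b ∉ S → b ∉ X → ¬ G.Adj a b

/-- `c` is a proper colouring of the subgraph of `G` induced by `S`. -/
def ProperOn (G : SimpleGraph V) (S : Set V) (c : V → Fin 3) : Prop :=
  ∀ ⦃x⦄, x ∈ S → ∀ ⦃y⦄, y ∈ S → G.Adj x y → c x ≠ c y

theorem ProperOn.mono {G : SimpleGraph V} {S T : Set V} {c : V → Fin 3} (h : ProperOn G T c)
    (hST : S ⊆ T) : ProperOn G S c :=
  fun _ hx _ hy hxy => h (hST hx) (hST hy) hxy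

theorem ProperOn.comp_perm {G : SimpleGraph V} {S : Set V} {c : V → Fin 3} (h : ProperOn G S c)
    (σ : Equiv.Perm (Fin 3)) : ProperOn G S (σ ∘ c) :=
  fun _ hx _ hy hxy he => h hx hy hxy (σ.injective he)

theorem VertexCritical.exists_properOn {G : SimpleGraph V} (h : VertexCritical 4 G) (v : V) :
    ∃ c : V → Fin 3, ProperOn G {v}ᶜ c := by
  classical
  have h3 : (G.induce ({v}ᶜ : Set V)).Colorable 3 := by
    rw [← chromaticNumber_le_iff_colorable]
    exact Order.le_of_lt_add_one ((h.2 v).trans_le (by norm_num))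
  obtain ⟨c⟩ := h3
  refine ⟨fun x => if hx : x ∈ ({v}ᶜ : Set V) then c ⟨x, hx⟩ else 0, fun x hx y hy hxy => ?_⟩
  simp only [dif_pos hx, dif_pos hy]
  exact c.valid (by simpa using hxy)

/-- A Kempe change: if `u` and `w` are not joined by a path avoiding the colour `γ`, then
`u` can be recoloured without affecting `w` and the colour class `γ`. -/
theorem ProperOn.reachable_or_exists_recolor {G : SimpleGraph V} {S : Set V} {c : V → Fin 3}
    (hc : ProperOn G S c) {γ : Fin 3} {u w : V} (hu : u ∈ {x ∈ S | c x ≠ γ})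
    (hw : w ∈ {x ∈ S | c x ≠ γ}) :
    (G.induce {x ∈ S | c x ≠ γ}).Reachable ⟨u, hu⟩ ⟨w, hw⟩ ∨
      ∃ c', ProperOn G S c' ∧ c' w = c w ∧ (∀ x, c x = γ → c' x = γ) ∧
        c' u ≠ c u ∧ c' u ≠ γ := by
  classical
  by_contra! hcon
  obtain ⟨hr, hcon⟩ := hcon
  obtain ⟨δ, hδ, hδγ⟩ : ∃ δ, δ ≠ c u ∧ δ ≠ γ :=
    (by decide : ∀ a b : Fin 3, ∃ δ, δ ≠ a ∧ δ ≠ b) _ _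
  let T : Set V := {x | ∃ hx : x ∈ {x ∈ S | c x ≠ γ},
    (G.induce {x ∈ S | c x ≠ γ}).Reachable ⟨u, hu⟩ ⟨x, hx⟩}
  have hTS : ∀ x ∈ T, x ∈ S ∧ c x ≠ γ := fun x ⟨hx, _⟩ => hx
  have hT : ∀ x ∈ T, ∀ y ∈ S, c y ≠ γ → G.Adj x y → y ∈ T := by
    rintro x ⟨hx, hxr⟩ y hy hyγ hxy
    exact ⟨⟨hy, hyγ⟩, hxr.trans (Adj.reachable (by simpa using hxy))⟩
  have huT : u ∈ T := ⟨hu, Reachable.refl _⟩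
  have hwT : w ∉ T := fun ⟨_, h⟩ => hr h
  have hsw : ∀ a, a ≠ γ → Equiv.swap (c u) δ a ≠ γ := by
    have := hu.2
    generalize c u = b at *
    intro a ha h
    rw [Equiv.swap_apply_eq_iff, Equiv.swap_apply_of_ne_of_ne this.symm hδγ.symm] at h
    exact ha h
  refine hδγ ?_
  have hrec := hcon (fun x => if x ∈ T then Equiv.swap (c u) δ (c x) else c x) ?_ (by simp [hwT])
    ?_ (by simpa [huT] using hδ)
  · simpa [huT] using hrec
  · intro x hx y hy hxy
    have hne := hc hx hy hxy
    by_cases hxT : x ∈ T <;> by_cases hyT : y ∈ T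
    · simpa [hxT, hyT] using hne
    · have hyγ : c y = γ := by
        by_contra h
        exact hyT (hT x hxT y hy h hxy)
      simpa [hxT, hyT, hyγ] using hsw _ (hTS x hxT).2
    · have hxγ : c x = γ := by
        by_contra h
        exact hxT (hT y hyT x hx h hxy.symm)
      simpa [hxT, hyT, hxγ] using (hsw _ (hTS y hyT).2).symm
    · simpa [hxT, hyT] using hne
  · intro x hx
    have : x ∉ T := fun h => (hTS x h).2 hx
    simpa [this] using hx

theorem isChordless_of_length_eq_dist {G : SimpleGraph V} {u w : V} (p : G.Walk u w)
    (hp : p.length = G.dist u w) : p.IsChordless := by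
  have key : ∀ i j, i < j → j ≤ p.length → G.Adj (p.getVert i) (p.getVert j) →
      s(p.getVert i, p.getVert j) ∈ p.edges := by
    intro i j hij hj hadj
    have h := dist_le ((p.take i).append (Walk.cons hadj (p.drop j)))
    rw [Walk.length_append, Walk.length_cons, Walk.take_length, Walk.drop_length] at h
    obtain rfl : j = i + 1 := by omega
    exact p.mk_mem_edges_iff_exists.2 ⟨i, by omega, rfl⟩
  rw [Walk.isChordless_iff_forall_mem_edges]
  intro x y hx hy hxy
  obtain ⟨i, rfl, hi⟩ := Walk.mem_support_iff_exists_getVert.1 hx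
  obtain ⟨j, rfl, hj⟩ := Walk.mem_support_iff_exists_getVert.1 hy
  rcases lt_trichotomy i j with h | rfl | h
  · exact key i j h hj hxy
  · exact absurd hxy G.irrefl
  · rw [Sym2.eq_swap]
    exact key j i h hi hxy.symm

/-- In a properly coloured set, two vertices connected off the colour class `γ` are joined by
an induced path whose parity is determined by their colours. -/
theorem ProperOn.exists_isInducedPath {G : SimpleGraph V} {S : Set V} {c : V → Fin 3}
    (hc : ProperOn G S c) {γ : Fin 3} {u w : V} (hu : u ∈ {x ∈ S | c x ≠ γ})
    (hw : w ∈ {x ∈ S | c x ≠ γ})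
    (hr : (G.induce {x ∈ S | c x ≠ γ}).Reachable ⟨u, hu⟩ ⟨w, hw⟩) :
    ∃ p : G.Walk u w, IsInducedPath G p ∧ (∀ x ∈ p.support, x ∈ S ∧ c x ≠ γ) ∧
      (Even p.length ↔ c u = c w) := by
  obtain ⟨p, hpath, hp⟩ := hr.exists_path_of_dist
  have hchord := isChordless_of_length_eq_dist p hp
  let f : G.induce {x ∈ S | c x ≠ γ} →g G := (Embedding.induce _).toHom
  let b : (G.induce {x ∈ S | c x ≠ γ}).Coloring Bool :=
    Coloring.mk (fun x => decide (c x = c u)) (by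
      intro x y hxy
      have key : ∀ a b d e : Fin 3, a ≠ b → a ≠ e → b ≠ e → d ≠ e →
          decide (a = d) ≠ decide (b = d) := by decide
      exact key _ _ _ _ (hc x.2.1 y.2.1 hxy) x.2.2 y.2.2 hu.2)
  obtain ⟨q, hqs, hqe, hql, hqp⟩ : ∃ q : G.Walk u w, q.support = p.support.map Subtype.val ∧
      q.edges = p.edges.map (Sym2.map Subtype.val) ∧ q.length = p.length ∧ q.IsPath :=
    ⟨p.map f, Walk.support_map _ _, Walk.edges_map _ _, Walk.length_map _ _,
      hpath.map Subtype.val_injective⟩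
  refine ⟨q, ⟨hqp, ?_⟩, ?_, ?_⟩
  · intro x hx y hy hxy
    rw [hqs, List.mem_map] at hx hy
    obtain ⟨x, hx, rfl⟩ := hx
    obtain ⟨y, hy, rfl⟩ := hy
    rw [hqe]
    exact List.mem_map.2 ⟨s(x, y), hchord.mem_edges hx hy hxy, rfl⟩
  · intro x hx
    rw [hqs, List.mem_map] at hx
    obtain ⟨x, hx, rfl⟩ := hx
    exact x.2
  · rw [hql, b.even_length_iff_congr p]
    simp [b, Coloring.mk, eq_comm]

/-- Two partial colourings whose common domain is `X` and that agree on `X` can be glued. -/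
theorem ProperOn.colorable_of_eqOn {G : SimpleGraph V} {A B : Set V} {c d : V → Fin 3}
    (hAB : ∀ x ∈ A, ∀ y ∈ B, ¬ G.Adj x y) (hc : ProperOn G Bᶜ c) (hd : ProperOn G Aᶜ d)
    (h : ∀ x, x ∉ A → x ∉ B → c x = d x) (hdisj : Disjoint A B) : G.Colorable 3 := by
  classical
  rw [Set.disjoint_left] at hdisj
  refine ⟨Coloring.mk (fun x => if x ∈ B then d x else c x) ?_⟩
  intro x y hxy
  by_cases hx : x ∈ B <;> by_cases hy : y ∈ B
  · simpa [hx, hy] using hd (fun h => hdisj h hx) (fun h => hdisj h hy) hxy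
  · have hyA : y ∉ A := fun h => hAB y h x hx hxy.symm
    simpa [hx, hy, h y hyA hy] using hd (fun h => hdisj h hx) hyA hxy
  · have hxA : x ∉ A := fun h => hAB x h y hy hxy
    simpa [hx, hy, h x hxA hx] using hd hxA (fun h => hdisj h hy) hxy
  · simpa [hx, hy] using hc hx hy hxy

theorem exists_separation_of_not_preconnected {G : SimpleGraph V} {X : Set V}
    (h : ¬ (G.induce (Xᶜ : Set V)).Preconnected) :
    ∃ A B : Set V, A.Nonempty ∧ B.Nonempty ∧ Disjoint A B ∧ (A ∪ B)ᶜ = X ∧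
      ∀ x ∈ A, ∀ y ∈ B, ¬ G.Adj x y := by
  simp only [Preconnected, not_forall] at h
  obtain ⟨a, b, hab⟩ := h
  let A : Set V := {x | ∃ hx : x ∈ Xᶜ, (G.induce (Xᶜ : Set V)).Reachable a ⟨x, hx⟩}
  refine ⟨A, Xᶜ \ A, ⟨a, a.2, Reachable.refl _⟩, ⟨b, b.2, fun ⟨_, h⟩ => hab h⟩,
    Set.disjoint_sdiff_right, ?_, ?_⟩
  · have : A ⊆ Xᶜ := fun x ⟨hx, _⟩ => hx
    rw [Set.union_sdiff_cancel this, compl_compl]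
  · rintro x ⟨hx, hxr⟩ y ⟨hy, hyA⟩ hxy
    exact hyA ⟨hy, hxr.trans (Adj.reachable (by simpa using hxy))⟩

theorem VertexCritical.not_hasK2Cut {G : SimpleGraph V} (hG : VertexCritical 4 G) :
    ¬ HasK2Cut G := by
  rintro ⟨u, v, huv, hcut⟩
  obtain ⟨A, B, ⟨a, ha⟩, ⟨b, hb⟩, hdisj, hX, hAB⟩ := exists_separation_of_not_preconnected hcut
  obtain ⟨c, hc⟩ := hG.exists_properOn b
  obtain ⟨d, hd⟩ := hG.exists_properOn a
  replace hc : ProperOn G Bᶜ c := hc.mono (by simpa using hb)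
  replace hd : ProperOn G Aᶜ d := hd.mono (by simpa using ha)
  have hmem : ∀ x, (x ∉ A ∧ x ∉ B) ↔ x = u ∨ x = v := fun x => by
    have := Set.ext_iff.1 hX x
    simpa using this
  have hu := (hmem u).2 (.inl rfl)
  have hv := (hmem v).2 (.inr rfl)
  obtain ⟨σ, h1, h2⟩ : ∃ σ : Equiv.Perm (Fin 3), c u = σ (d u) ∧ c v = σ (d v) := by
    have h1 := hc hu.2 hv.2 huv
    have h2 := hd hu.1 hv.1 huv
    revert h1 h2
    generalize c u = a1
    generalize c v = a2
    generalize d u = a3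
    generalize d v = a4
    revert a1 a2 a3 a4
    decide
  have h3 : G.Colorable 3 := hc.colorable_of_eqOn hAB (hd.comp_perm σ) (fun x hxA hxB => by
    rcases (hmem x).1 ⟨hxA, hxB⟩ with rfl | rfl
    exacts [h1, h2]) hdisj
  have := chromaticNumber_le_iff_colorable.2 h3
  rw [hG.1] at this
  exact absurd this (by norm_num)

/-- The cycle formed by an induced path between two neighbours `u`, `w` of `v` that avoids `v`
bounds the girth. -/
theorem egirth_le_length_add_two {G : SimpleGraph V} {u v w : V} (huv : G.Adj u v)
    (hvw : G.Adj v w) (huw : u ≠ w) {p : G.Walk u w} (hp : p.IsPath) (hv : v ∉ p.support) :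
    G.egirth ≤ (p.length + 2 : ℕ) := by
  have hq : (Walk.cons hvw.symm (Walk.cons huv.symm Walk.nil)).IsPath := by
    simp [Walk.cons_isPath_iff, huw.symm, huv.ne', hvw.ne']
  refine (egirth_le_length (hp.isCycle_append hq ?_ (by simp))).trans (by simp)
  rw [List.disjoint_left]
  intro x hx hx'
  have hnd := hp.support_nodup
  rw [← Walk.cons_tail_support, List.nodup_cons] at hnd
  simp only [Walk.support_cons, Walk.support_nil, List.tail_cons, List.mem_cons,
    List.not_mem_nil, or_false] at hx'
  rcases hx' with rfl | rfl
  · exact hv (List.mem_of_mem_tail hx)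
  · exact hnd.1 hx

/-- Two induced paths with the same ends, the rest of which lie in sets with no edges between
them, form a hole. -/
theorem isHole_append_reverse {G : SimpleGraph V} {A B : Set V} {u w : V}
    (hdisj : Disjoint A B) (hAB : ∀ x ∈ A, ∀ y ∈ B, ¬ G.Adj x y) {p q : G.Walk u w}
    (hp : IsInducedPath G p) (hq : IsInducedPath G q)
    (hpA : ∀ x ∈ p.support, x ∈ A ∨ x = u ∨ x = w) (hqB : ∀ x ∈ q.support, x ∈ B ∨ x = u ∨ x = w)
    (hpl : 2 ≤ p.length) (hql : 2 ≤ q.length) : IsHole G (p.append q.reverse) := by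
  rw [Set.disjoint_left] at hdisj
  have hor : ∀ x ∈ p.support, ∀ y ∈ q.support, G.Adj x y →
      s(x, y) ∈ p.edges ∨ s(x, y) ∈ q.edges := by
    intro x hx y hy hxy
    by_cases hx' : x = u ∨ x = w
    · refine .inr (hq.2 x ?_ y hy hxy)
      rcases hx' with rfl | rfl
      exacts [q.start_mem_support, q.end_mem_support]
    by_cases hy' : y = u ∨ y = w
    · refine .inl (hp.2 x hx y ?_ hxy)
      rcases hy' with rfl | rfl
      exacts [p.start_mem_support, p.end_mem_support]
    exact absurd hxy (hAB x ((hpA x hx).resolve_right hx') y ((hqB y hy).resolve_right hy'))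
  refine ⟨hp.1.isCycle_append hq.1.reverse ?_ (.inl (by omega)), ?_, ?_⟩
  · rw [List.disjoint_left]
    intro x hx hx'
    have h1 := hp.1.support_nodup
    have h2 := hq.1.reverse.support_nodup
    rw [← Walk.cons_tail_support, List.nodup_cons] at h1 h2
    have hxu : x ≠ u := by rintro rfl; exact h1.1 hx
    have hxw : x ≠ w := by rintro rfl; exact h2.1 hx'
    have hxp := hpA x (List.mem_of_mem_tail hx)
    have hxq := hqB x (by simpa using List.mem_of_mem_tail hx')
    exact hdisj (hxp.resolve_right (by simp [hxu, hxw])) (hxq.resolve_right (by simp [hxu, hxw]))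
  · rw [Walk.length_append, Walk.length_reverse]
    omega
  · intro x hx y hy hxy
    rw [Walk.mem_support_append_iff, Walk.support_reverse, List.mem_reverse] at hx hy
    rw [Walk.edges_append, Walk.edges_reverse, List.mem_append, List.mem_reverse]
    rcases hx with hx | hx <;> rcases hy with hy | hy
    · exact .inl (hp.2 x hx y hy hxy)
    · exact hor x hx y hy hxy
    · rw [Sym2.eq_swap]
      exact hor y hy x hx hxy.symm
    · exact .inr (hq.2 x hx y hy hxy)

/-- Across a `P₃`-cut `u v w`, no colouring of one side with `u` and `w` equally coloured
coexists with only unequal colourings on the other side. -/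
theorem InGFamily.false_of_forced_colors {ℓ : ℕ} (hℓ : 2 ≤ ℓ) {G : SimpleGraph V}
    (hG : InGFamily ℓ G) {A B : Set V} {u v w : V} (huv : G.Adj u v) (hvw : G.Adj v w)
    (huw : u ≠ w) (hdisj : Disjoint A B) (hAB : ∀ x ∈ A, ∀ y ∈ B, ¬ G.Adj x y)
    (hmem : ∀ x, (x ∉ A ∧ x ∉ B) ↔ x = u ∨ x = v ∨ x = w) {c d : V → Fin 3}
    (hc : ProperOn G Bᶜ c) (hd : ProperOn G Aᶜ d)
    (hce : ∀ c', ProperOn G Bᶜ c' → c' u = c' w) (hde : ∀ d', ProperOn G Aᶜ d' → d' u ≠ d' w) :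
    False := by
  have hu := (hmem u).2 (.inl rfl)
  have hv := (hmem v).2 (.inr (.inl rfl))
  have hw := (hmem w).2 (.inr (.inr rfl))
  have hcu : u ∈ {x ∈ Bᶜ | c x ≠ c v} := ⟨hu.2, hc hu.2 hv.2 huv⟩
  have hcw : w ∈ {x ∈ Bᶜ | c x ≠ c v} := ⟨hw.2, (hc hv.2 hw.2 hvw).symm⟩
  have hdu : u ∈ {x ∈ Aᶜ | d x ≠ d v} := ⟨hu.1, hd hu.1 hv.1 huv⟩
  have hdw : w ∈ {x ∈ Aᶜ | d x ≠ d v} := ⟨hw.1, (hd hv.1 hw.1 hvw).symm⟩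
  have hrc := (hc.reachable_or_exists_recolor hcu hcw).resolve_right (by
    rintro ⟨c', hc', h1, -, h2, -⟩
    exact h2 ((hce c' hc').trans (h1.trans (hce c hc).symm)))
  have hrd := (hd.reachable_or_exists_recolor hdu hdw).resolve_right (by
    rintro ⟨d', hd', h1, -, h2, h3⟩
    have key : ∀ a b e f : Fin 3, a ≠ b → a ≠ e → b ≠ e → b ≠ f → f ≠ e → a = f := by decide
    exact hde d' hd' (h1 ▸ key _ _ _ _ h2 h3 hdu.2 (hde d hd) hdw.2))
  obtain ⟨p, hp, hps, hpe⟩ := hc.exists_isInducedPath hcu hcw hrc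
  obtain ⟨q, hq, hqs, hqe⟩ := hd.exists_isInducedPath hdu hdw hrd
  replace hpe : Even p.length := hpe.2 (hce c hc)
  replace hqe : Odd q.length := Nat.not_even_iff_odd.1 (fun h => hde d hd (hqe.1 h))
  have hpl := egirth_le_length_add_two huv hvw huw hp.1 (fun h => (hps v h).2 rfl)
  have hql := egirth_le_length_add_two huv hvw huw hq.1 (fun h => (hqs v h).2 rfl)
  rw [hG.1, Nat.cast_le] at hpl hql
  have hhole : IsHole G (p.append q.reverse) := by
    refine isHole_append_reverse hdisj hAB hp hq (fun x hx => ?_) (fun x hx => ?_)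
      (by omega) (by omega)
    · by_contra! hcon
      rcases (hmem x).1 ⟨hcon.1, (hps x hx).1⟩ with h | rfl | h
      exacts [hcon.2.1 h, (hps x hx).2 rfl, hcon.2.2 h]
    · by_contra! hcon
      rcases (hmem x).1 ⟨(hqs x hx).1, hcon.1⟩ with h | rfl | h
      exacts [hcon.2.1 h, (hqs x hx).2 rfl, hcon.2.2 h]
  have hlen : (p.append q.reverse).length = p.length + q.length := by
    rw [Walk.length_append, Walk.length_reverse]
  have := hG.2 u _ ⟨hhole, hlen ▸ hpe.add_odd hqe⟩
  obtain ⟨k, hk⟩ := hpe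
  omega

theorem InGFamily.not_hasP3Cut {ℓ : ℕ} (hℓ : 2 ≤ ℓ) {G : SimpleGraph V}
    (hG : InGFamily ℓ G) (hcrit : VertexCritical 4 G) : ¬ HasP3Cut G := by
  rintro ⟨u, v, w, huv, hvw, huw, hcut⟩
  obtain ⟨A, B, ⟨a, ha⟩, ⟨b, hb⟩, hdisj, hX, hAB⟩ := exists_separation_of_not_preconnected hcut
  obtain ⟨c, hc⟩ := hcrit.exists_properOn b
  obtain ⟨d, hd⟩ := hcrit.exists_properOn a
  replace hc : ProperOn G Bᶜ c := hc.mono (by simpa using hb)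
  replace hd : ProperOn G Aᶜ d := hd.mono (by simpa using ha)
  have hmem : ∀ x, (x ∉ A ∧ x ∉ B) ↔ x = u ∨ x = v ∨ x = w := fun x => by
    have := Set.ext_iff.1 hX x
    simpa using this
  have hu := (hmem u).2 (.inl rfl)
  have hv := (hmem v).2 (.inr (.inl rfl))
  have hw := (hmem w).2 (.inr (.inr rfl))
  have hdiff : ∀ c' d', ProperOn G Bᶜ c' → ProperOn G Aᶜ d' →
      ¬ (c' u = c' w ↔ d' u = d' w) := by
    intro c' d' hc' hd' hiff
    obtain ⟨σ, h1, h2, h3⟩ : ∃ σ : Equiv.Perm (Fin 3),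
        c' u = σ (d' u) ∧ c' v = σ (d' v) ∧ c' w = σ (d' w) := by
      have h1 := hc' hu.2 hv.2 huv
      have h2 := hd' hu.1 hv.1 huv
      have h3 := hc' hv.2 hw.2 hvw
      have h4 := hd' hv.1 hw.1 hvw
      revert h1 h2 h3 h4 hiff
      generalize c' u = a1
      generalize c' v = a2
      generalize c' w = a3
      generalize d' u = a4
      generalize d' v = a5
      generalize d' w = a6
      revert a1 a2 a3 a4 a5 a6
      decide
    have h3 : G.Colorable 3 := hc'.colorable_of_eqOn hAB (hd'.comp_perm σ) (fun x hxA hxB => by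
      rcases (hmem x).1 ⟨hxA, hxB⟩ with rfl | rfl | rfl
      exacts [h1, h2, h3]) hdisj
    have := chromaticNumber_le_iff_colorable.2 h3
    rw [hcrit.1] at this
    exact absurd this (by norm_num)
  by_cases h : c u = c w
  · have hde : ∀ d', ProperOn G Aᶜ d' → d' u ≠ d' w := fun d' hd' h' =>
      hdiff c d' hc hd' (iff_of_true h h')
    refine hG.false_of_forced_colors hℓ huv hvw huw hdisj hAB hmem hc hd (fun c' hc' => ?_) hde
    by_contra h'
    exact hdiff c' d hc' hd (iff_of_false h' (hde d hd))
  · have hde : ∀ d', ProperOn G Aᶜ d' → d' u = d' w := fun d' hd' => by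
      by_contra h'
      exact hdiff c d' hc hd' (iff_of_false h h')
    refine hG.false_of_forced_colors hℓ huv hvw huw hdisj.symm
      (fun x hx y hy hxy => hAB y hy x hx hxy.symm) (fun x => and_comm.trans (hmem x)) hd hc hde
      (fun c' hc' h' => ?_)
    exact hdiff c' d hc' hd (iff_of_true h' (hde d hd))

/-- Lemma 2.3: for every `ℓ ≥ 2`, every 4-vertex-critical graph in `𝒢ℓ`
has neither a `K₂`-cut nor a `P₃`-cut. -/
theorem no_K2_cut_no_P3_cut {V : Type*} (ℓ : ℕ) (hℓ : 2 ≤ ℓ) (G : SimpleGraph V)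
    (hG : InGFamily ℓ G) (hcrit : VertexCritical 4 G) :
    ¬ HasK2Cut G ∧ ¬ HasP3Cut G :=
  ⟨hcrit.not_hasK2Cut, hG.not_hasP3Cut hℓ hcrit⟩
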